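/- Let φ : R → S be a homomorphism of rings (not necessarily commutative). Then the following are equivalent: (a) for every left S-module M the canonical map η_M : M → Hom_R(S, M), m ↦ (s ↦ s • m), is bijective and Ext^i_R(S, M) = 0 for all i ≥ 1; (b) for all left S-modules M, M' and all i ≥ 0, the natural map Ext^i_S(M, M') → Ext^i_R(M, M') induced by restriction of scalars is an isomorphism. -/

import Mathlib

/-!
Homological epimorphisms of rings (Geigle–Lenzing).
`φ : R →+* S`; every `S`-module is an `R`-module by restriction of scalars.
-/

universe w u

open CategoryTheory Limits DerivedCategory

noncomputable section

namespace RingHomEpi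

variable {R S : Type u} [Ring R] [Ring S] (φ : R →+* S)

instance : (ModuleCat.restrictScalars.{u} φ).Additive where
  map_add := rfl

/-- `S` regarded as an `R`-module via `φ`. -/
abbrev SasR : ModuleCat.{u} R := (ModuleCat.restrictScalars φ).obj (ModuleCat.of S S)

/-- The canonical map `η_M : M → Hom_R(S, M)`, `m ↦ (s ↦ s • m)`. -/
def etaMap (M : ModuleCat.{u} S) :
    M → (SasR φ →ₗ[R] (ModuleCat.restrictScalars φ).obj M) := fun m =>
  { toFun := fun s => (show S from s) • (show M from m)
    map_add' := fun s t => add_smul (show S from s) (show S from t) (show M from m)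
    map_smul' := fun r s => by
      show (φ r • (show S from s)) • (show M from m) =
        φ r • ((show S from s) • (show M from m))
      exact smul_assoc (φ r) (show S from s) (show M from m) }

/-- Restriction of scalars is compatible with the forgetful functors to abelian groups. -/
def restrictScalarsCompForget₂Iso :
    ModuleCat.restrictScalars.{u} φ ⋙ forget₂ (ModuleCat.{u} R) AddCommGrpCat ≅
      forget₂ (ModuleCat.{u} S) AddCommGrpCat :=
  NatIso.ofComponents (fun _ => Iso.refl _) (fun _ => rfl)

instance : PreservesFiniteLimits (ModuleCat.restrictScalars.{u} φ) := by
  have : PreservesFiniteLimits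
      (ModuleCat.restrictScalars.{u} φ ⋙ forget₂ (ModuleCat.{u} R) AddCommGrpCat) :=
    preservesFiniteLimits_of_natIso (restrictScalarsCompForget₂Iso φ).symm
  exact preservesFiniteLimits_of_reflects_of_preserves _
    (forget₂ (ModuleCat.{u} R) AddCommGrpCat)

instance : PreservesFiniteColimits (ModuleCat.restrictScalars.{u} φ) := by
  have : PreservesFiniteColimits
      (ModuleCat.restrictScalars.{u} φ ⋙ forget₂ (ModuleCat.{u} R) AddCommGrpCat) :=
    preservesFiniteColimits_of_natIso (restrictScalarsCompForget₂Iso φ).symm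
  exact preservesFiniteColimits_of_reflects_of_preserves _
    (forget₂ (ModuleCat.{u} R) AddCommGrpCat)

attribute [local instance] CategoryTheory.hasExt_of_hasDerivedCategory

variable [HasDerivedCategory.{w} (ModuleCat.{u} R)]
  [HasDerivedCategory.{w} (ModuleCat.{u} S)]

/-- The functor `D(φ) : D(S) → D(R)` induced by restriction of scalars along `φ`. -/
abbrev Dphi : DerivedCategory (ModuleCat.{u} S) ⥤ DerivedCategory (ModuleCat.{u} R) :=
  (ModuleCat.restrictScalars.{u} φ).mapDerivedCategory

/-- `D(φ)` commutes with the single complex functors. -/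
def singleObjIso (M : ModuleCat.{u} S) :
    (Dphi φ).obj ((DerivedCategory.singleFunctor (ModuleCat.{u} S) 0).obj M) ≅
      (DerivedCategory.singleFunctor (ModuleCat.{u} R) 0).obj
        ((ModuleCat.restrictScalars φ).obj M) :=
  (Dphi φ).mapIso
    (((SingleFunctors.evaluation _ _ 0).mapIso
      (DerivedCategory.singleFunctorsPostcompQIso (ModuleCat.{u} S))).app M)
  ≪≫ ((ModuleCat.restrictScalars.{u} φ).mapDerivedCategoryFactors.app _)
  ≪≫ DerivedCategory.Q.mapIso
      ((HomologicalComplex.singleMapHomologicalComplex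
        (ModuleCat.restrictScalars.{u} φ) (ComplexShape.up ℤ) 0).app M)
  ≪≫ (((SingleFunctors.evaluation _ _ 0).mapIso
      (DerivedCategory.singleFunctorsPostcompQIso (ModuleCat.{u} R))).symm.app _)

/-- The natural comparison map `Ext^n_S(M, M') → Ext^n_R(M, M')` induced by
restriction of scalars along `φ`. -/
def extMap {M M' : ModuleCat.{u} S} {n : ℕ} (e : Abelian.Ext.{w} M M' n) :
    Abelian.Ext.{w} ((ModuleCat.restrictScalars φ).obj M)
      ((ModuleCat.restrictScalars φ).obj M') n :=
  Abelian.Ext.homEquiv.symm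
    ((singleObjIso φ M).inv ≫ (Dphi φ).map e.hom ≫
      ((Dphi φ).commShiftIso (n : ℤ)).hom.app _ ≫
      (shiftFunctor (DerivedCategory (ModuleCat.{u} R)) (n : ℤ)).map
        (singleObjIso φ M').hom)


/-- `Ext` vanishing out of a coproduct, from vanishing out of the summands. -/
lemma ext_subsingleton_of_isColimit {D : Type*} [Category D] [Abelian D] [HasExt.{w} D]
    [EnoughInjectives D] {I : Type*} {X : I → D} (c : Cofan X) (hc : IsColimit c) (n : ℕ) :
    ∀ (N : D) (_ : ∀ (i : I) (k : ℕ), Subsingleton (Abelian.Ext.{w} (X i) N (k + 1))),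
      Subsingleton (Abelian.Ext.{w} c.pt N (n + 1)) := by
  induction n with
  | zero =>
    intro N hN
    let J : InjectivePresentation N := Classical.arbitrary _
    let T := ShortComplex.mk _ _ (cokernel.condition J.f)
    have hT : T.ShortExact := { exact := ShortComplex.exact_cokernel J.f }
    have : Injective T.X₂ := J.injective
    refine subsingleton_of_forall_eq 0 fun e => ?_
    obtain ⟨x, rfl⟩ := Abelian.Ext.covariant_sequence_exact₁ _ hT e
      (Abelian.Ext.eq_zero_of_injective _) (n₀ := 0) rfl
    obtain ⟨f, rfl⟩ := (Abelian.Ext.mk₀_bijective _ _).2 x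
    have h : ∀ i, ∃ g : X i ⟶ T.X₂, g ≫ T.g = c.inj i ≫ f := by
      intro i
      obtain ⟨y, hy⟩ := Abelian.Ext.covariant_sequence_exact₃ _ hT
        (Abelian.Ext.mk₀ (c.inj i ≫ f)) (n₁ := 1) rfl ((hN i 0).elim _ _)
      obtain ⟨g, rfl⟩ := (Abelian.Ext.mk₀_bijective _ _).2 y
      refine ⟨g, (Abelian.Ext.mk₀_bijective _ _).1 ?_⟩
      rw [← hy, Abelian.Ext.mk₀_comp_mk₀]
    choose g hg using h
    have hf : f = Cofan.IsColimit.desc hc g ≫ T.g := by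
      refine Cofan.IsColimit.hom_ext hc _ _ fun i => ?_
      rw [← hg, Cofan.IsColimit.fac_assoc]
    rw [hf, ← Abelian.Ext.mk₀_comp_mk₀, Abelian.Ext.comp_assoc_of_second_deg_zero]
    simp
  | succ n ih =>
    intro N hN
    let J : InjectivePresentation N := Classical.arbitrary _
    let T := ShortComplex.mk _ _ (cokernel.condition J.f)
    have hT : T.ShortExact := { exact := ShortComplex.exact_cokernel J.f }
    have : Injective T.X₂ := J.injective
    have hC : ∀ (i : I) (k : ℕ), Subsingleton (Abelian.Ext.{w} (X i) T.X₃ (k + 1)) := by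
      intro i k
      refine subsingleton_of_forall_eq 0 fun e => ?_
      obtain ⟨x, rfl⟩ := Abelian.Ext.covariant_sequence_exact₃ _ hT e (n₁ := k + 1 + 1) rfl
        ((hN i (k + 1)).elim _ _)
      rw [Abelian.Ext.eq_zero_of_injective x]
      simp
    have := ih T.X₃ hC
    refine subsingleton_of_forall_eq 0 fun e => ?_
    obtain ⟨x, rfl⟩ := Abelian.Ext.covariant_sequence_exact₁ _ hT e
      (Abelian.Ext.eq_zero_of_injective _) (n₀ := n + 1) rfl
    rw [Subsingleton.elim x 0]
    simp

lemma singleObjIso_hom (M : ModuleCat.{u} S) :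
    (singleObjIso φ M).hom =
      ((ModuleCat.restrictScalars.{u} φ).mapDerivedCategorySingleFunctor 0).hom.app M := by
  have a : ((singleFunctorsPostcompQIso (ModuleCat.{u} S)).hom.hom 0).app M =
      𝟙 ((singleFunctor (ModuleCat.{u} S) 0).obj M) :=
    NatTrans.congr_app (singleFunctorsPostcompQIso_hom_hom (C := ModuleCat.{u} S) 0) M
  have b : ((singleFunctorsPostcompQIso (ModuleCat.{u} R)).inv.hom 0).app
      ((ModuleCat.restrictScalars φ).obj M) =
      𝟙 ((singleFunctor (ModuleCat.{u} R) 0).obj ((ModuleCat.restrictScalars φ).obj M)) :=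
    NatTrans.congr_app (singleFunctorsPostcompQIso_inv_hom (C := ModuleCat.{u} R) 0) _
  refine Eq.trans (b := (Dphi φ).map (𝟙 ((singleFunctor (ModuleCat.{u} S) 0).obj M)) ≫
    (ModuleCat.restrictScalars.{u} φ).mapDerivedCategoryFactors.hom.app
      ((CochainComplex.singleFunctor (ModuleCat.{u} S) 0).obj M) ≫
    DerivedCategory.Q.map ((HomologicalComplex.singleMapHomologicalComplex
        (ModuleCat.restrictScalars.{u} φ) (ComplexShape.up ℤ) 0).hom.app M) ≫
    𝟙 ((singleFunctor (ModuleCat.{u} R) 0).obj ((ModuleCat.restrictScalars φ).obj M))) ?_ ?_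
  · rw [← a, ← b]
    rfl
  · symm
    refine Eq.trans (b := (Dphi φ).map (𝟙 ((singleFunctor (ModuleCat.{u} S) 0).obj M)) ≫
      𝟙 _ ≫
      (ModuleCat.restrictScalars.{u} φ).mapDerivedCategoryFactors.hom.app
        ((CochainComplex.singleFunctor (ModuleCat.{u} S) 0).obj M) ≫ 𝟙 _ ≫
      DerivedCategory.Q.map ((HomologicalComplex.singleMapHomologicalComplex
          (ModuleCat.restrictScalars.{u} φ) (ComplexShape.up ℤ) 0).hom.app M) ≫ 𝟙 _ ≫
      𝟙 ((singleFunctor (ModuleCat.{u} R) 0).obj ((ModuleCat.restrictScalars φ).obj M))) ?_ ?_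
    · rfl
    · rw [Category.id_comp, Category.id_comp]
      erw [Category.id_comp]

lemma singleObjIso_eq (M : ModuleCat.{u} S) :
    singleObjIso φ M =
      ((ModuleCat.restrictScalars.{u} φ).mapDerivedCategorySingleFunctor 0).app M :=
  Iso.ext (singleObjIso_hom φ M)

lemma extMap_eq {M M' : ModuleCat.{u} S} {n : ℕ} (e : Abelian.Ext.{w} M M' n) :
    extMap φ e = Abelian.Ext.mapExactFunctor.{w, w} (ModuleCat.restrictScalars.{u} φ) e := by
  apply Abelian.Ext.homEquiv.injective
  refine Eq.trans ?_ (Abelian.Ext.mapExactFunctor_hom _ e).symm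
  rw [extMap, Equiv.apply_symm_apply, singleObjIso_eq, singleObjIso_eq]
  simp [ShiftedHom.map]

/-- An `S`-module is covered by a coproduct of copies of `S`. -/
def cover (M : ModuleCat.{u} S) : (∐ fun _ : M => ModuleCat.of S S) ⟶ M :=
  Sigma.desc fun m => ModuleCat.ofHom (LinearMap.toSpanSingleton S M m)

instance (M : ModuleCat.{u} S) : Epi (cover M) := by
  rw [ModuleCat.epi_iff_surjective]
  intro m
  refine ⟨(Sigma.ι (fun _ : M => ModuleCat.of S S) m).hom (1 : S), ?_⟩
  have := ConcreteCategory.congr_hom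
    (Sigma.ι_desc (fun m : M => ModuleCat.ofHom (LinearMap.toSpanSingleton S M m)) m) (1 : S)
  refine Eq.trans this ?_
  exact one_smul S m

instance : Projective (ModuleCat.of S S) :=
  ModuleCat.projective_of_free (Module.Basis.singleton PUnit.{1} S)

lemma full_of_eta (h : ∀ M : ModuleCat.{u} S, Function.Bijective (etaMap φ M)) :
    (ModuleCat.restrictScalars.{u} φ).Full where
  map_surjective {M M'} f := by
    have key : ∀ (s : S) (m : M), f.hom (show M from s • m) = (s • (show M' from f.hom m) : M') := by
      intro s m
      obtain ⟨n, hn⟩ := (h M').2 (f.hom.comp (etaMap φ M m))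
      have h1 : ∀ s : S, (s • n : M') = f.hom (show M from s • m) := fun s =>
        LinearMap.congr_fun hn s
      have h2 : n = f.hom m := by
        have := h1 1
        rwa [one_smul, one_smul] at this
      rw [← h1, h2]
    exact ⟨ModuleCat.ofHom
      { toFun := fun m => f.hom m
        map_add' := fun a b => f.hom.map_add a b
        map_smul' := fun s m => key s m }, rfl⟩

attribute [local simp] Abelian.Ext.mapExactFunctor_comp Abelian.Ext.mapExactFunctor_mk₀ Abelian.Ext.mapExactFunctor_extClass

lemma mapExt_bijective {C D : Type*} [Category C] [Category D] [Abelian C] [Abelian D]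
    [HasExt.{w} C] [HasExt.{w} D] (F : C ⥤ D) [F.Additive]
    [PreservesFiniteLimits F] [PreservesFiniteColimits F] [F.Full] [F.Faithful]
    (hF : ∀ X : C, ∃ (P : C) (p : P ⟶ X), Epi p ∧ Projective P ∧ ∀ (Y : C) (n : ℕ),
      Subsingleton (Abelian.Ext.{w} (F.obj P) (F.obj Y) (n + 1)))
    (X Y : C) (n : ℕ) :
    Function.Bijective (F.mapExtAddHom X Y n) := by
  induction n generalizing X with
  | zero =>
    simpa [Abelian.Ext.mapExactFunctor₀] using
      ⟨Functor.Faithful.map_injective, Functor.Full.map_surjective⟩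
  | succ n hn =>
    obtain ⟨P, p, _, _, hP⟩ := hF X
    let T := ShortComplex.mk _ _ (kernel.condition p)
    have hT : T.ShortExact := { exact := ShortComplex.exact_kernel p }
    have h1 : Subsingleton (Abelian.Ext.{w} T.X₂ Y (n + 1)) :=
      Abelian.Ext.subsingleton_of_projective _ _ _
    have h2 : Subsingleton (Abelian.Ext.{w} (T.map F).X₂ (F.obj Y) (n + 1)) := hP Y n
    exact AddMonoidHom.bijective_of_surjective_of_bijective_of_right_exact _ _ _ _
      (F.mapExtAddHom T.X₂ Y n) (F.mapExtAddHom T.X₁ Y n) (F.mapExtAddHom T.X₃ Y (n + 1))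
      (by cat_disch)
      (by cat_disch)
      ((ShortComplex.ab_exact_iff_function_exact _).1
        (Abelian.Ext.contravariant_sequence_exact₁' hT Y n (n + 1) (add_comm 1 n)))
      ((ShortComplex.ab_exact_iff_function_exact _).1
        (Abelian.Ext.contravariant_sequence_exact₁' (hT.map F) (F.obj Y) n (n + 1) (add_comm 1 n)))
      (hn _).surjective (hn _)
      (fun x₃ ↦ Abelian.Ext.contravariant_sequence_exact₃ hT _ x₃ (h1.elim _ _) (add_comm 1 n))
      (fun y₃ ↦ Abelian.Ext.contravariant_sequence_exact₃ (hT.map F) _ y₃ (h2.elim _ _)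
        (add_comm 1 n))

/-- For a ring homomorphism `φ : R →+* S`, the following are equivalent:
(a) for every left `S`-module `M`, `η_M : M → Hom_R(S,M)` is bijective and
`Ext^i_R(S,M) = 0` for all `i ≥ 1`;
(b) for all left `S`-modules `M, M'` and all `i ≥ 0`, the natural map
`Ext^i_S(M,M') → Ext^i_R(M,M')` induced by restriction of scalars is an isomorphism. -/
theorem eta_bijective_and_ext_vanishing_iff_extMap_bijective :
    (∀ M : ModuleCat.{u} S, Function.Bijective (etaMap φ M) ∧
      ∀ i : ℕ, 1 ≤ i →
        Subsingleton (Abelian.Ext.{w} (SasR φ) ((ModuleCat.restrictScalars φ).obj M) i)) ↔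
    (∀ (M M' : ModuleCat.{u} S) (i : ℕ),
      Function.Bijective (fun e : Abelian.Ext.{w} M M' i => extMap φ e)) := by
  simp only [extMap_eq]
  constructor
  · intro h M M' i
    have := full_of_eta φ fun M => (h M).1
    refine mapExt_bijective.{w} (ModuleCat.restrictScalars.{u} φ) ?_ M M' i
    intro M
    refine ⟨_, cover M, inferInstance, inferInstance, fun M' n => ?_⟩
    have hc := isColimitCofanMkObjOfIsColimit (ModuleCat.restrictScalars.{u} φ) _ _
      (coproductIsCoproduct fun _ : M => ModuleCat.of S S)
    exact ext_subsingleton_of_isColimit.{w} _ hc n _ fun _ k => (h M').2 (k + 1) (by omega)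
  · intro h M
    constructor
    · have h0 := h (ModuleCat.of S S) M 0
      have h0 : Function.Bijective (fun e : Abelian.Ext.{w} (ModuleCat.of S S) M 0 =>
        Abelian.Ext.mapExactFunctor.{w, w} (ModuleCat.restrictScalars.{u} φ) e) := h0
      rw [Abelian.Ext.mapExactFunctor₀] at h0
      have h1 : Function.Bijective fun f : ModuleCat.of S S ⟶ M =>
          (ModuleCat.restrictScalars.{u} φ).map f := by
        rwa [Equiv.comp_bijective, Equiv.bijective_comp] at h0
      constructor
      · intro a b hab
        have := LinearMap.congr_fun hab (1 : S)
        have h2 : (1 : S) • a = (1 : S) • b := this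
        simpa using h2
      · intro f
        obtain ⟨g, hg⟩ := h1.2 (ModuleCat.ofHom (X := SasR φ)
          (Y := (ModuleCat.restrictScalars φ).obj M) f)
        refine ⟨g.hom (1 : S), LinearMap.ext fun s => ?_⟩
        have h2 : g.hom s = f s := ConcreteCategory.congr_hom hg s
        refine Eq.trans ?_ h2
        refine (g.hom.map_smul (show S from s) (1 : S)).symm.trans ?_
        congr 1
        exact mul_one (show S from s)
    · intro i hi
      obtain ⟨k, rfl⟩ : ∃ k, i = k + 1 := ⟨i - 1, by omega⟩
      have := Abelian.Ext.subsingleton_of_projective.{w} (ModuleCat.of S S) M k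
      exact (h (ModuleCat.of S S) M (k + 1)).2.subsingleton


end RingHomEpi
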